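/- arXiv:2503.10203 — 2 statements merged into one kernel-verified Lean document; each statement's English description precedes it below -/
import Mathlib

section
/- Correctness of the full rounding procedure: if x⁰ is a global minimizer of f over the relaxed feasible set Ω_rel and s is any selection function assigning to each block i : Fin n an index s(i) : Fin (l i) with x⁰ i (s i) > 0, then the point x̂ whose i-th block equals e_{s(i)} for every i belongs to the integer feasible set Ω_int and is a global minimizer of f over Ω_rel (hence also over Ω_int). -/
open Finset

/-- The CPD objective `f(x) = ∑_{i<j} ∑_r ∑_s b i j r s * x i r * x j s + ∑_i ∑_r a i r * x i r`. -/
noncomputable def cpdObj {n : ℕ} {l : Fin n → ℕ}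
    (a : (i : Fin n) → Fin (l i) → ℝ)
    (b : (i j : Fin n) → Fin (l i) → Fin (l j) → ℝ)
    (x : (i : Fin n) → Fin (l i) → ℝ) : ℝ :=
  (∑ i, ∑ j, if i < j then ∑ r, ∑ s, b i j r s * x i r * x j s else 0)
    + ∑ i, ∑ r, a i r * x i r

/-- The relaxed feasible set `Ω_rel`. -/
def relFeas {n : ℕ} (l : Fin n → ℕ) : Set ((i : Fin n) → Fin (l i) → ℝ) :=
  {x | (∀ i r, 0 ≤ x i r) ∧ ∀ i, ∑ r, x i r = 1}

/-- The integer (0/1) feasible set `Ω_int`. -/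
def intFeas {n : ℕ} (l : Fin n → ℕ) : Set ((i : Fin n) → Fin (l i) → ℝ) :=
  {x | x ∈ relFeas l ∧ ∀ i r, x i r = 0 ∨ x i r = 1}

/-- `g` agrees at `w` with the barycentric combination of its values at unit vectors. -/
def BaryAt {m : ℕ} (w : Fin m → ℝ) (g : (Fin m → ℝ) → ℝ) : Prop :=
  g w = ∑ t, w t * g (fun r => if r = t then (1 : ℝ) else 0)

lemma BaryAt.const {m : ℕ} {w : Fin m → ℝ} (hw : ∑ t, w t = 1) (c : ℝ) :
    BaryAt w (fun _ => c) := by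
  simp [BaryAt, ← Finset.sum_mul, hw]

lemma BaryAt.coord {m : ℕ} {w : Fin m → ℝ} (r : Fin m) :
    BaryAt w (fun v => v r) := by
  simp [BaryAt]

lemma BaryAt.add {m : ℕ} {w : Fin m → ℝ} {g h : (Fin m → ℝ) → ℝ}
    (hg : BaryAt w g) (hh : BaryAt w h) : BaryAt w (fun v => g v + h v) := by
  unfold BaryAt at *
  simp only [mul_add, Finset.sum_add_distrib]
  rw [← hg, ← hh]

lemma BaryAt.const_mul {m : ℕ} {w : Fin m → ℝ} {g : (Fin m → ℝ) → ℝ}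
    (hg : BaryAt w g) (c : ℝ) : BaryAt w (fun v => c * g v) := by
  unfold BaryAt at *
  simp only [mul_left_comm _ c, ← Finset.mul_sum]
  rw [← hg]

lemma BaryAt.sum {m : ℕ} {w : Fin m → ℝ} {ι : Type*} (S : Finset ι)
    {g : ι → (Fin m → ℝ) → ℝ}
    (hg : ∀ i, BaryAt w (g i)) : BaryAt w (fun v => ∑ i ∈ S, g i v) := by
  unfold BaryAt at *
  simp only [Finset.mul_sum]
  rw [Finset.sum_comm]
  exact Finset.sum_congr rfl fun i _ => hg i

lemma baryAt_update {n : ℕ} {l : Fin n → ℕ} (x : (i : Fin n) → Fin (l i) → ℝ) (k : Fin n)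
    {w : Fin (l k) → ℝ} (hw : ∑ t, w t = 1) (i : Fin n) (r : Fin (l i)) :
    BaryAt w (fun v => Function.update x k v i r) := by
  by_cases h : i = k
  · subst h
    simpa using BaryAt.coord r
  · simpa [Function.update_of_ne h] using BaryAt.const hw (x i r)

lemma baryAt_cpdObj {n : ℕ} {l : Fin n → ℕ}
    (a : (i : Fin n) → Fin (l i) → ℝ)
    (b : (i j : Fin n) → Fin (l i) → Fin (l j) → ℝ)
    (x : (i : Fin n) → Fin (l i) → ℝ) (k : Fin n)
    {w : Fin (l k) → ℝ} (hw : ∑ t, w t = 1) :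
    BaryAt w (fun v => cpdObj a b (Function.update x k v)) := by
  unfold cpdObj
  refine BaryAt.add (BaryAt.sum _ fun i => BaryAt.sum _ fun j => ?_)
    (BaryAt.sum _ fun i => BaryAt.sum _ fun r => (baryAt_update x k hw i r).const_mul _)
  by_cases hij : i < j
  · simp only [hij, if_true]
    refine BaryAt.sum _ fun r => BaryAt.sum _ fun s => ?_
    by_cases hj : j = k
    · have hi : i ≠ k := fun h => by subst h; subst hj; exact lt_irrefl _ hij
      simp only [Function.update_of_ne hi]
      exact (baryAt_update x k hw j s).const_mul _
    · simp only [Function.update_of_ne hj, mul_right_comm _ _ (x j s)]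
      exact (baryAt_update x k hw i r).const_mul _
  · simp only [hij, if_false]
    exact BaryAt.const hw 0

lemma update_mem_relFeas {n : ℕ} {l : Fin n → ℕ} {x : (i : Fin n) → Fin (l i) → ℝ}
    (hx : x ∈ relFeas l) (k : Fin n) (t : Fin (l k)) :
    Function.update x k (fun r => if r = t then (1 : ℝ) else 0) ∈ relFeas l := by
  refine ⟨fun i r => ?_, fun i => ?_⟩
  · by_cases h : i = k
    · subst h
      simp only [Function.update_self]
      split_ifs <;> norm_num
    · simpa [Function.update_of_ne h] using hx.1 i r
  · by_cases h : i = k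
    · subst h
      simp
    · simpa [Function.update_of_ne h] using hx.2 i

/-- Rounding a single block of a minimizer keeps the objective value. -/
lemma round_block {n : ℕ} {l : Fin n → ℕ}
    (a : (i : Fin n) → Fin (l i) → ℝ)
    (b : (i j : Fin n) → Fin (l i) → Fin (l j) → ℝ)
    {x : (i : Fin n) → Fin (l i) → ℝ} (hx : x ∈ relFeas l)
    (hmin : ∀ y ∈ relFeas l, cpdObj a b x ≤ cpdObj a b y)
    (k : Fin n) (t : Fin (l k)) (ht : 0 < x k t) :
    cpdObj a b (Function.update x k (fun r => if r = t then (1 : ℝ) else 0))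
      = cpdObj a b x := by
  have h1 := baryAt_cpdObj a b x k (hx.2 k)
  have h2 := BaryAt.const (hx.2 k) (cpdObj a b x)
  unfold BaryAt at h1 h2
  simp only [Function.update_eq_self] at h1
  have h3 : ∀ r ∈ (Finset.univ : Finset (Fin (l k))), x k r * cpdObj a b x ≤ x k r *
      cpdObj a b (Function.update x k (fun q => if q = r then (1 : ℝ) else 0)) :=
    fun r _ => mul_le_mul_of_nonneg_left (hmin _ (update_mem_relFeas hx k r)) (hx.1 k r)
  have h4 := (Finset.sum_eq_sum_iff_of_le h3).1 (h2.symm.trans h1) t (Finset.mem_univ t)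
  exact (mul_left_cancel₀ ht.ne' h4).symm

/-- correctness of the full rounding procedure. -/
theorem cpd_full_rounding_correct
    (n : ℕ) (hn : 1 ≤ n) (l : Fin n → ℕ) (hl : ∀ i, 1 ≤ l i)
    (a : (i : Fin n) → Fin (l i) → ℝ)
    (b : (i j : Fin n) → Fin (l i) → Fin (l j) → ℝ)
    (x0 : (i : Fin n) → Fin (l i) → ℝ) (hx0 : x0 ∈ relFeas l)
    (hmin : ∀ y ∈ relFeas l, cpdObj a b x0 ≤ cpdObj a b y)
    (s : (i : Fin n) → Fin (l i)) (hs : ∀ i, 0 < x0 i (s i)) :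
    (fun i r => if r = s i then (1 : ℝ) else 0) ∈ intFeas l ∧
      (∀ y ∈ relFeas l,
        cpdObj a b (fun i r => if r = s i then (1 : ℝ) else 0) ≤ cpdObj a b y) ∧
      (∀ y ∈ intFeas l,
        cpdObj a b (fun i r => if r = s i then (1 : ℝ) else 0) ≤ cpdObj a b y) := by
  have key : ∀ T : Finset (Fin n), ∃ x ∈ relFeas l, cpdObj a b x = cpdObj a b x0 ∧
      ∀ i, x i = if i ∈ T then (fun r => if r = s i then (1 : ℝ) else 0) else x0 i := by
    intro T
    induction T using Finset.induction_on with
    | empty => exact ⟨x0, hx0, rfl, by simp⟩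
    | insert k T hk ih =>
      obtain ⟨x, hx, hv, hform⟩ := ih
      have hpos : 0 < x k (s k) := by
        rw [hform k, if_neg hk]
        exact hs k
      refine ⟨_, update_mem_relFeas hx k (s k), ?_, fun i => ?_⟩
      · rw [round_block a b hx (fun y hy => hv ▸ hmin y hy) k (s k) hpos, hv]
      · by_cases h : i = k
        · subst h
          simp
        · rw [Function.update_of_ne h, hform i]
          simp [h]
  obtain ⟨x, hx, hv, hform⟩ := key Finset.univ
  have hxe : x = fun i r => if r = s i then (1 : ℝ) else 0 := by
    funext i
    simpa using hform i
  subst hxe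
  refine ⟨⟨hx, fun i r => ?_⟩, fun y hy => hv ▸ hmin y hy, fun y hy => hv ▸ hmin y hy.1⟩
  by_cases h : r = s i
  · right; simp [h]
  · left; simp [h]
end

section
/- Any global minimizer of f over the integer feasible set Ω_int is also a global minimizer of f over the relaxed feasible set Ω_rel. -/
open Finset

/-- `y` with block `k` replaced by the `t`-th vertex of the simplex. -/
noncomputable def cpdUpd {n : ℕ} {l : Fin n → ℕ} (y : (i : Fin n) → Fin (l i) → ℝ)
    (k : Fin n) (t : Fin (l k)) : (i : Fin n) → Fin (l i) → ℝ :=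
  Function.update y k (Pi.single t 1)

lemma cpdUpd_lin {n : ℕ} {l : Fin n → ℕ} (y : (i : Fin n) → Fin (l i) → ℝ)
    (hy : y ∈ relFeas l) (k i : Fin n) (r : Fin (l i)) :
    ∑ t, y k t * cpdUpd y k t i r = y i r := by
  by_cases h : i = k
  · subst h
    simp [cpdUpd, Pi.single_apply]
  · simp [cpdUpd, Function.update_of_ne h, ← Finset.sum_mul, hy.2 k]

lemma cpdUpd_bil {n : ℕ} {l : Fin n → ℕ} (y : (i : Fin n) → Fin (l i) → ℝ)
    (hy : y ∈ relFeas l) (k i j : Fin n) (hij : i ≠ j) (r : Fin (l i)) (s : Fin (l j)) :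
    ∑ t, y k t * (cpdUpd y k t i r * cpdUpd y k t j s) = y i r * y j s := by
  by_cases h : i = k
  · have hj : j ≠ k := fun e => hij (h.trans e.symm)
    have : ∀ t, cpdUpd y k t j s = y j s := fun t => by
      simp [cpdUpd, Function.update_of_ne hj]
    simp only [this, ← mul_assoc, ← Finset.sum_mul, cpdUpd_lin y hy]
  · have : ∀ t, cpdUpd y k t i r = y i r := fun t => by
      simp [cpdUpd, Function.update_of_ne h]
    simp only [this, mul_left_comm _ (y i r), ← Finset.mul_sum, cpdUpd_lin y hy]

lemma cpdObj_avg {n : ℕ} {l : Fin n → ℕ}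
    (a : (i : Fin n) → Fin (l i) → ℝ)
    (b : (i j : Fin n) → Fin (l i) → Fin (l j) → ℝ) (y : (i : Fin n) → Fin (l i) → ℝ)
    (hy : y ∈ relFeas l) (k : Fin n) :
    ∑ t, y k t * cpdObj a b (cpdUpd y k t) = cpdObj a b y := by
  unfold cpdObj
  simp only [mul_add, Finset.sum_add_distrib]
  congr 1
  · simp only [Finset.mul_sum]
    rw [Finset.sum_comm]
    refine Finset.sum_congr rfl fun i _ => ?_
    rw [Finset.sum_comm]
    refine Finset.sum_congr rfl fun j _ => ?_
    split_ifs with h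
    · simp only [Finset.mul_sum]
      rw [Finset.sum_comm]
      refine Finset.sum_congr rfl fun r _ => ?_
      rw [Finset.sum_comm]
      refine Finset.sum_congr rfl fun s _ => ?_
      rw [mul_assoc, ← cpdUpd_bil y hy k i j h.ne r s, Finset.mul_sum]
      exact Finset.sum_congr rfl fun t _ => by ring
    · simp
  · simp only [Finset.mul_sum]
    rw [Finset.sum_comm]
    refine Finset.sum_congr rfl fun i _ => ?_
    rw [Finset.sum_comm]
    refine Finset.sum_congr rfl fun r _ => ?_
    rw [← cpdUpd_lin y hy k i r, Finset.mul_sum]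
    exact Finset.sum_congr rfl fun t _ => by ring

lemma cpdUpd_mem {n : ℕ} {l : Fin n → ℕ} (y : (i : Fin n) → Fin (l i) → ℝ)
    (hy : y ∈ relFeas l) (k : Fin n) (t : Fin (l k)) : cpdUpd y k t ∈ relFeas l := by
  refine ⟨fun i r => ?_, fun i => ?_⟩
  · by_cases h : i = k
    · subst h
      simp only [cpdUpd, Function.update_self, Pi.single_apply]
      split_ifs <;> norm_num
    · simpa [cpdUpd, Function.update_of_ne h] using hy.1 i r
  · by_cases h : i = k
    · subst h
      simp [cpdUpd]
    · simpa [cpdUpd, Function.update_of_ne h] using hy.2 i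

lemma cpd_exists_vertex {n : ℕ} {l : Fin n → ℕ}
    (a : (i : Fin n) → Fin (l i) → ℝ)
    (b : (i j : Fin n) → Fin (l i) → Fin (l j) → ℝ) (y : (i : Fin n) → Fin (l i) → ℝ)
    (hy : y ∈ relFeas l) (k : Fin n) :
    ∃ t, cpdObj a b (cpdUpd y k t) ≤ cpdObj a b y := by
  by_contra hcon
  push Not at hcon
  have h1 : ∑ t, y k t * (cpdObj a b (cpdUpd y k t) - cpdObj a b y) = 0 := by
    simp only [mul_sub, Finset.sum_sub_distrib, cpdObj_avg a b y hy, ← Finset.sum_mul, hy.2 k]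
    ring
  rw [Finset.sum_eq_zero_iff_of_nonneg
    (fun t _ => mul_nonneg (hy.1 k t) (sub_nonneg.2 (hcon t).le))] at h1
  have h2 : ∀ t, y k t = 0 := fun t =>
    (mul_eq_zero.1 (h1 t (Finset.mem_univ t))).resolve_right (sub_pos.2 (hcon t)).ne'
  have h3 := hy.2 k
  simp [h2] at h3

lemma cpd_round {n : ℕ} {l : Fin n → ℕ}
    (a : (i : Fin n) → Fin (l i) → ℝ)
    (b : (i j : Fin n) → Fin (l i) → Fin (l j) → ℝ) (y : (i : Fin n) → Fin (l i) → ℝ)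
    (hy : y ∈ relFeas l) (S : Finset (Fin n)) :
    ∃ z ∈ relFeas l, (∀ i ∈ S, ∀ r, z i r = 0 ∨ z i r = 1) ∧ cpdObj a b z ≤ cpdObj a b y := by
  induction S using Finset.induction_on with
  | empty => exact ⟨y, hy, by simp, le_rfl⟩
  | insert k S _ ih =>
    obtain ⟨z, hz, hS, hle⟩ := ih
    obtain ⟨t, ht⟩ := cpd_exists_vertex a b z hz k
    refine ⟨cpdUpd z k t, cpdUpd_mem z hz k t, fun i hi r => ?_, ht.trans hle⟩
    by_cases h : i = k
    · subst h
      simp only [cpdUpd, Function.update_self, Pi.single_apply]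
      split_ifs <;> simp
    · have := hS i ((Finset.mem_insert.1 hi).resolve_left h) r
      simpa [cpdUpd, Function.update_of_ne h] using this

/-- a global minimizer over `Ω_int` is a global minimizer over `Ω_rel`. -/
theorem cpd_integer_minimizer_is_relaxed_minimizer
    (n : ℕ) (hn : 1 ≤ n) (l : Fin n → ℕ) (hl : ∀ i, 1 ≤ l i)
    (a : (i : Fin n) → Fin (l i) → ℝ)
    (b : (i j : Fin n) → Fin (l i) → Fin (l j) → ℝ)
    (x : (i : Fin n) → Fin (l i) → ℝ) (hx : x ∈ intFeas l)
    (hmin : ∀ y ∈ intFeas l, cpdObj a b x ≤ cpdObj a b y) :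
    ∀ y ∈ relFeas l, cpdObj a b x ≤ cpdObj a b y := by
  intro y hy
  obtain ⟨z, hz, hS, hle⟩ := cpd_round a b y hy Finset.univ
  exact (hmin z ⟨hz, fun i r => hS i (Finset.mem_univ i) r⟩).trans hle
end
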